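/- For ℓ ≥ 1 and natural numbers s_0, …, s_ℓ, m, x, say that DP(s_0, …, s_ℓ, m, x) holds if there exist integers d_1 ≥ d_2 ≥ … ≥ d_{s_0} ≥ 0 with d_i ≤ m for all i ∈ [1, s_0], and a finite simple graph G whose degree multiset is {d_1, …, d_{s_0}} together with x copies of 1, such that |V(G)| = s_0 + x, 2·|E(G)| = s_1 + x, and sub(S_j, G) = s_j for every j ∈ [2, ℓ]. Then for all natural numbers s_0, …, s_ℓ, m, x with s_0 ≥ 2 and s_1 ≥ 1, DP(s_0, …, s_ℓ, m, x) holds if and only if there exist d ∈ [1, m], n_1 ∈ [1, s_0], and natural numbers s'_0, …, s'_ℓ, m', x' satisfying: d ≤ n_1 − 1 + x; s'_0 = n_1 − 1; s_j = s'_j + C(d, j) + s'_{j−1} for every j ∈ [1, ℓ]; m' = d − 1; x' + d = x + n_1 − 1 + 0 (i.e. x' = x + n_1 − 1 − d); and DP(s'_0, …, s'_ℓ, m', x') holds. -/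

import Mathlib

/-- The star `S_j` with `j` leaves: vertex `0` is the centre, adjacent to the `j` leaves. -/
def starGraph (j : ℕ) : SimpleGraph (Fin (j + 1)) :=
  SimpleGraph.fromRel (fun a _ => a = 0)

/-- The number of subgraphs of `G` isomorphic to `F`. -/
noncomputable def subCount {α β : Type*} (F : SimpleGraph α) (G : SimpleGraph β) : ℕ :=
  Nat.card {H : G.Subgraph // Nonempty (F ≃g H.coe)}

/-- The multiset of vertex degrees of a finite simple graph. -/
noncomputable def degreeMultiset {V : Type*} [Fintype V] (G : SimpleGraph V) : Multiset ℕ :=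
  Finset.univ.val.map fun v => (G.neighborSet v).ncard

/-- `DP ℓ s m x` holds iff there exist `d 1 ≥ … ≥ d (s 0) ≥ 0` with `d i ≤ m`
and a finite simple graph `G` whose degree multiset is `{d 1, …, d (s 0)}` together
with `x` copies of `1`, with `|V(G)| = s 0 + x`, `2·|E(G)| = s 1 + x`, and
`sub(S_j, G) = s j` for all `j ∈ [2, ℓ]`. -/
def DP (ℓ : ℕ) (s : ℕ → ℕ) (m x : ℕ) : Prop :=
  ∃ d : ℕ → ℕ,
    (∀ i j, 1 ≤ i → i ≤ j → j ≤ s 0 → d j ≤ d i) ∧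
    (∀ i ∈ Finset.Icc 1 (s 0), d i ≤ m) ∧
    ∃ (V : Type) (_ : Fintype V) (G : SimpleGraph V),
      degreeMultiset G = (Finset.Icc 1 (s 0)).val.map d + Multiset.replicate x 1 ∧
      Fintype.card V = s 0 + x ∧
      2 * G.edgeSet.ncard = s 1 + x ∧
      ∀ j ∈ Finset.Icc 2 ℓ, subCount (starGraph j) G = s j

/-- The degree of a vertex, as the cardinality of its neighbour set. -/
noncomputable def ndeg {V : Type*} (G : SimpleGraph V) (v : V) : ℕ := (G.neighborSet v).ncard

/-- A multiset of naturals is graphic if it is the degree multiset of a finite simple graph. -/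
def Graphic (M : Multiset ℕ) : Prop :=
  ∃ (V : Type) (_ : Fintype V) (G : SimpleGraph V), degreeMultiset G = M

section Degrees

variable {V : Type*}

lemma ndeg_sup_edge [Finite V] [DecidableEq V] (G : SimpleGraph V) {a b : V} (hab : a ≠ b)
    (h : ¬ G.Adj a b) (v : V) :
    ndeg (G ⊔ SimpleGraph.edge a b) v = ndeg G v + if v = a ∨ v = b then 1 else 0 := by
  have h' : ¬ G.Adj b a := fun h' => h h'.symm
  unfold ndeg
  split_ifs with hv
  · rcases hv with rfl | rfl
    · have : (G ⊔ SimpleGraph.edge v b).neighborSet v = insert b (G.neighborSet v) := by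
        ext x
        simp only [SimpleGraph.mem_neighborSet, SimpleGraph.sup_adj, SimpleGraph.edge_adj,
          Set.mem_insert_iff]
        grind
      rw [this, Set.ncard_insert_of_notMem (by simpa using h) (Set.toFinite _)]
    · have : (G ⊔ SimpleGraph.edge a v).neighborSet v = insert a (G.neighborSet v) := by
        ext x
        simp only [SimpleGraph.mem_neighborSet, SimpleGraph.sup_adj, SimpleGraph.edge_adj,
          Set.mem_insert_iff]
        grind
      rw [this, Set.ncard_insert_of_notMem (by simpa using h') (Set.toFinite _)]
  · congr 1
    ext x
    simp only [SimpleGraph.mem_neighborSet, SimpleGraph.sup_adj, SimpleGraph.edge_adj]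
    grind

lemma ndeg_deleteEdge [Finite V] [DecidableEq V] (G : SimpleGraph V) {a b : V}
    (h : G.Adj a b) (v : V) :
    ndeg G v = ndeg (G.deleteEdges {s(a, b)}) v + if v = a ∨ v = b then 1 else 0 := by
  rw [← ndeg_sup_edge _ h.ne (by simp)]
  congr 1
  ext x y
  simp only [SimpleGraph.sup_adj, SimpleGraph.edge_adj, SimpleGraph.deleteEdges_adj,
    Set.mem_singleton_iff, Sym2.eq_iff]
  have := h.symm
  have := @SimpleGraph.Adj.ne _ G
  grind

/-- Adjoin a vertex `none` joined to the vertices in `U`. -/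
def coneGraph (G : SimpleGraph V) (U : Finset V) : SimpleGraph (Option V) where
  Adj a b := match a, b with
    | none, none => False
    | none, some u => u ∈ U
    | some u, none => u ∈ U
    | some u, some w => G.Adj u w
  symm := ⟨by
    rintro (_ | a) (_ | b) h
    · exact h
    · exact h
    · exact h
    · exact h.symm⟩
  loopless := ⟨by
    rintro (_ | a) h
    · exact h
    · exact G.irrefl h⟩

lemma ndeg_coneGraph_none (G : SimpleGraph V) (U : Finset V) :
    ndeg (coneGraph G U) none = U.card := by
  have : (coneGraph G U).neighborSet none = some '' (U : Set V) := by
    ext (_ | x) <;> simp [coneGraph]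
  rw [ndeg, this, Set.ncard_image_of_injective _ (Option.some_injective V), Set.ncard_coe_finset]

lemma ndeg_coneGraph_some [Finite V] [DecidableEq V] (G : SimpleGraph V) (U : Finset V) (v : V) :
    ndeg (coneGraph G U) (some v) = ndeg G v + if v ∈ U then 1 else 0 := by
  unfold ndeg
  split_ifs with hv
  · have : (coneGraph G U).neighborSet (some v) = insert none (some '' (G.neighborSet v)) := by
      ext (_ | x) <;> simp [coneGraph, hv]
    rw [this, Set.ncard_insert_of_notMem (by simp) (Set.toFinite _),
      Set.ncard_image_of_injective _ (Option.some_injective V)]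
  · have : (coneGraph G U).neighborSet (some v) = some '' (G.neighborSet v) := by
      ext (_ | x) <;> simp [coneGraph, hv]
    rw [this, Set.ncard_image_of_injective _ (Option.some_injective V), add_zero]

/-- Degree can be transferred away from a vertex of large degree by absorbing pendant vertices. -/
lemma exists_absorb_leaves [Finite V] [DecidableEq V] {v : V} {d : ℕ}
    (L : Finset V) (hvL : v ∉ L) (G : SimpleGraph V)
    (hL : ∀ l ∈ L, ndeg G l = 1 ∧ ¬ G.Adj v l) (hv : ndeg G v = d + L.card)
    (hle : ∀ w, w ≠ v → ndeg G w ≤ d) :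
    ∃ H : SimpleGraph V, ndeg H v = d ∧ ∀ w, w ≠ v → ndeg H w = if w ∈ L then 0 else ndeg G w := by
  induction L using Finset.induction_on generalizing G with
  | empty => exact ⟨G, by simpa using hv, by simp⟩
  | insert l L hl ih =>
    rw [Finset.card_insert_of_notMem hl] at hv
    have hl1 := hL l (Finset.mem_insert_self _ _)
    have hlv : l ≠ v := by rintro rfl; simp at hvL
    obtain ⟨w, hw⟩ := Set.ncard_eq_one.1 hl1.1
    have hlw : G.Adj l w := by
      have : w ∈ G.neighborSet l := by rw [hw]; rfl
      exact this
    have hwv : w ≠ v := by rintro rfl; exact hl1.2 hlw.symm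
    have hlt : (insert w (G.neighborSet w \ {l})).ncard < (G.neighborSet v).ncard := by
      have h1 := Set.ncard_insert_le w (G.neighborSet w \ {l})
      have h2 := Set.ncard_sdiff_singleton_add_one (s := G.neighborSet w) (a := l) hlw.symm
        (Set.toFinite _)
      have h3 := hle w hwv
      unfold ndeg at h3 hv
      omega
    obtain ⟨u, huv, hu⟩ := Set.exists_mem_notMem_of_ncard_lt_ncard hlt (Set.toFinite _)
    rw [SimpleGraph.mem_neighborSet] at huv
    have hul : u ≠ l := by rintro rfl; exact hl1.2 huv
    have huw : u ≠ w := by rintro rfl; simp at hu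
    have hnuw : ¬ G.Adj u w := by
      intro h
      exact hu (Set.mem_insert_of_mem _ ⟨h.symm, hul⟩)
    set G₁ := G.deleteEdges {s(v, u)} with hG₁
    have hlw₁ : G₁.Adj l w := by
      simp only [hG₁, SimpleGraph.deleteEdges_adj, Set.mem_singleton_iff, Sym2.eq_iff]
      exact ⟨hlw, by tauto⟩
    set G₂ := G₁.deleteEdges {s(l, w)} with hG₂
    have hnuw₂ : ¬ G₂.Adj u w := by
      simp only [hG₁, hG₂, SimpleGraph.deleteEdges_adj]
      tauto
    have key : ∀ x, ndeg (G₂ ⊔ SimpleGraph.edge u w) x + (if x = v ∨ x = l then 1 else 0)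
        = ndeg G x := by
      intro x
      rw [ndeg_sup_edge _ huw hnuw₂, ndeg_deleteEdge G huv x, ndeg_deleteEdge _ hlw₁ x]
      have := huv.ne
      have := hlw.ne
      grind
    obtain ⟨H, hH1, hH2⟩ := ih (by simp_all) (G₂ ⊔ SimpleGraph.edge u w)
      (by
        intro a ha
        have hav : a ≠ v := by rintro rfl; simp [ha] at hvL
        have hal : a ≠ l := by rintro rfl; exact hl ha
        have hk := key a
        have hLa := hL a (Finset.mem_insert_of_mem ha)
        refine ⟨by simpa [hav, hal, hLa.1] using hk, ?_⟩
        simp only [hG₁, hG₂, SimpleGraph.sup_adj, SimpleGraph.deleteEdges_adj,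
          SimpleGraph.edge_adj]
        have := huv.ne
        tauto)
      (by have := key v; simp at this; omega)
      (fun a ha => by have := key a; have := hle a ha; omega)
    refine ⟨H, hH1, fun a ha => ?_⟩
    rw [hH2 a ha]
    have hk := key a
    by_cases hal : a = l
    · subst hal
      rw [hl1.1] at hk
      simp [hl] at hk ⊢
      exact hk
    · simp [ha, hal] at hk ⊢
      rw [hk]

end Degrees

section Multisets

variable {V : Type*}

lemma degreeMultiset_eq_map [Fintype V] (G : SimpleGraph V) :
    degreeMultiset G = Finset.univ.val.map (ndeg G) := rfl

lemma univ_option_map [Fintype V] (f : Option V → ℕ) :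
    (Finset.univ : Finset (Option V)).val.map f
      = f none ::ₘ (Finset.univ : Finset V).val.map (fun v => f (some v)) := by
  rw [univ_option]
  simp [Finset.insertNone, Finset.cons_val, Multiset.map_map]

lemma exists_erase_of_map_eq_cons [DecidableEq V] {s : Finset V} {f : V → ℕ}
    {a : ℕ} {R : Multiset ℕ} (h : s.val.map f = a ::ₘ R) :
    ∃ v ∈ s, f v = a ∧ (s.erase v).val.map f = R := by
  have : a ∈ s.val.map f := by rw [h]; exact Multiset.mem_cons_self _ _
  obtain ⟨v, hv, rfl⟩ := Multiset.mem_map.1 this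
  refine ⟨v, hv, rfl, ?_⟩
  rw [← Multiset.cons_erase hv, Multiset.map_cons, Multiset.cons_inj_right] at h
  simpa using h

lemma exists_sdiff_of_map_eq_add [DecidableEq V] {s : Finset V} {f : V → ℕ}
    {A B : Multiset ℕ} (h : s.val.map f = A + B) :
    ∃ t ⊆ s, t.val.map f = A ∧ (s \ t).val.map f = B := by
  induction A using Multiset.induction_on generalizing s with
  | empty => exact ⟨∅, by simp, by simp, by simpa using h⟩
  | cons a A ih =>
    rw [Multiset.cons_add] at h
    obtain ⟨v, hv, rfl, h'⟩ := exists_erase_of_map_eq_cons h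
    obtain ⟨t, ht, h1, h2⟩ := ih h'
    have hvt : v ∉ t := fun h => by simpa using ht h
    refine ⟨insert v t, ?_, ?_, ?_⟩
    · grind
    · rw [Finset.insert_val_of_notMem hvt, Multiset.map_cons, h1]
    · rw [← h2]
      congr 2
      ext x
      grind

end Multisets

lemma Graphic.cons_zero {M : Multiset ℕ} (h : Graphic M) : Graphic (0 ::ₘ M) := by
  classical
  obtain ⟨V, _, G, rfl⟩ := h
  refine ⟨Option V, inferInstance, coneGraph G ∅, ?_⟩
  simp [degreeMultiset_eq_map, univ_option_map, ndeg_coneGraph_none, ndeg_coneGraph_some]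

lemma Graphic.add_replicate_zero {M : Multiset ℕ} (h : Graphic M) (k : ℕ) :
    Graphic (M + Multiset.replicate k 0) := by
  induction k with
  | zero => simpa using h
  | succ k ih => simpa [Multiset.replicate_succ] using ih.cons_zero

/-- Deleting a vertex of degree `d` lowers exactly `d` other degrees by one. -/
lemma Graphic.delete_vertex {d : ℕ} {R : Multiset ℕ} (h : Graphic (d ::ₘ R)) :
    ∃ S T : Multiset ℕ, S.card = d ∧ R = S.map (· + 1) + T ∧ Graphic (S + T) := by
  classical
  obtain ⟨V, _, G, hG⟩ := h
  rw [degreeMultiset_eq_map] at hG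
  obtain ⟨v, -, hv, hR⟩ := exists_erase_of_map_eq_cons hG
  let W := {x : V // x ≠ v}
  let H : SimpleGraph W := G.comap Subtype.val
  have hdeg : ∀ x : W, ndeg G x = ndeg H x + if G.Adj v x then 1 else 0 := by
    intro x
    have himg : Subtype.val '' (H.neighborSet x) = G.neighborSet x \ {v} := by
      ext y
      simp [H, W, and_comm]
    have hcard : ndeg H x = (G.neighborSet x \ {v}).ncard := by
      rw [← himg, Set.ncard_image_of_injective _ Subtype.val_injective, ndeg]
    rw [hcard]
    split_ifs with hx
    · exact (Set.ncard_sdiff_singleton_add_one hx.symm (Set.toFinite _)).symm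
    · rw [Set.sdiff_singleton_eq_self (fun h' => hx h'.symm), ndeg, add_zero]
  have hW : R = (Finset.univ : Finset W).val.map (fun x : W => ndeg G x.1) := by
    rw [← hR]
    have : Finset.univ.erase v = (Finset.univ : Finset W).map (Function.Embedding.subtype _) := by
      ext x
      simp [W]
    rw [this, Finset.map_val, Multiset.map_map]
    rfl
  have hsplit : ∀ f : W → ℕ, (Finset.univ : Finset W).val.map f
      = (Finset.univ.filter fun x : W => G.Adj v x).val.map f
        + (Finset.univ.filter fun x : W => ¬ G.Adj v x).val.map f := by
    intro f
    rw [← Multiset.map_add, Finset.filter_val, Finset.filter_val, Multiset.filter_add_not]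
  refine ⟨(Finset.univ.filter fun x : W => G.Adj v x).val.map (ndeg H),
    (Finset.univ.filter fun x : W => ¬ G.Adj v x).val.map (ndeg H), ?_, ?_,
    ⟨W, inferInstance, H, by rw [degreeMultiset_eq_map, hsplit]⟩⟩
  · rw [Multiset.card_map, ← hv, ndeg]
    have : G.neighborSet v
        = ((Finset.univ.filter fun x : W => G.Adj v x).map (Function.Embedding.subtype _) :
          Set V) := by
      ext x
      simp only [SimpleGraph.mem_neighborSet, Finset.coe_map, Finset.coe_filter, Finset.mem_univ,
        true_and, Set.mem_image, Set.mem_ofPred_eq, Function.Embedding.subtype_apply]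
      exact ⟨fun hx => ⟨⟨x, hx.ne'⟩, hx, rfl⟩, by rintro ⟨y, hy, rfl⟩; exact hy⟩
    rw [this, Set.ncard_coe_finset, Finset.card_map]
    rfl
  · rw [hW, hsplit, Multiset.map_map]
    congr 1
    · refine Multiset.map_congr rfl fun x hx => ?_
      have : G.Adj v x := by simpa using hx
      simp [hdeg, this]
    · refine Multiset.map_congr rfl fun x hx => ?_
      have : ¬ G.Adj v x := by simpa using hx
      simp [hdeg, this]

lemma Graphic.of_cons_zero {M : Multiset ℕ} (h : Graphic (0 ::ₘ M)) : Graphic M := by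
  obtain ⟨S, T, hS, rfl, hG⟩ := h.delete_vertex
  rw [Multiset.card_eq_zero] at hS
  simpa [hS] using hG

lemma Graphic.of_add_replicate_zero {M : Multiset ℕ} {k : ℕ}
    (h : Graphic (M + Multiset.replicate k 0)) : Graphic M := by
  induction k with
  | zero => simpa using h
  | succ k ih =>
    rw [Multiset.replicate_succ, Multiset.add_cons] at h
    exact ih h.of_cons_zero

/-- An edge end can be split off a vertex into a new pendant vertex. -/
lemma Graphic.split {b : ℕ} {R : Multiset ℕ} (h : Graphic ((b + 1) ::ₘ R)) :
    Graphic (b ::ₘ 1 ::ₘ R) := by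
  classical
  obtain ⟨V, _, G, hG⟩ := h
  rw [degreeMultiset_eq_map] at hG
  obtain ⟨u, -, hu, hR⟩ := exists_erase_of_map_eq_cons hG
  obtain ⟨w, hw⟩ : (G.neighborSet u).Nonempty := by
    apply Set.nonempty_of_ncard_ne_zero
    unfold ndeg at hu
    omega
  rw [SimpleGraph.mem_neighborSet] at hw
  set G₁ := coneGraph G ∅ with hG₁
  have huw : G₁.Adj (some u) (some w) := hw
  set G₂ := G₁.deleteEdges {s(some u, some w)} with hG₂
  have hn : ¬ G₂.Adj none (some w) := by
    simp [hG₂, hG₁, SimpleGraph.deleteEdges_adj, coneGraph]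
  have hdeg := fun x => ndeg_sup_edge G₂ (by simp) hn x
  have hdel := fun x => ndeg_deleteEdge G₁ huw x
  have hnone : ndeg (G₂ ⊔ SimpleGraph.edge none (some w)) none = 1 := by
    have h1 := hdeg none
    have h2 := hdel none
    rw [hG₁, ndeg_coneGraph_none, ← hG₁, ← hG₂, Finset.card_empty] at h2
    simp only [true_or, if_true, reduceCtorEq, or_self, if_false] at h1 h2
    omega
  have hsome : ∀ x, ndeg (G₂ ⊔ SimpleGraph.edge none (some w)) (some x)
      = if x = u then b else ndeg G x := by
    intro x
    have h1 := hdeg (some x)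
    have h2 := hdel (some x)
    rw [hG₁, ndeg_coneGraph_some] at h2
    have := hw.ne
    simp only [Option.some.injEq, Finset.notMem_empty, if_false, reduceCtorEq] at h1 h2
    grind
  refine ⟨Option V, inferInstance, G₂ ⊔ SimpleGraph.edge none (some w), ?_⟩
  rw [degreeMultiset_eq_map, univ_option_map, hnone, Multiset.cons_swap, ← hR]
  congr 1
  have : (Finset.univ : Finset V).val = u ::ₘ (Finset.univ.erase u).val := by
    rw [Finset.erase_val, Multiset.cons_erase (Finset.mem_univ u)]
  rw [this, Multiset.map_cons, hsome, if_pos rfl]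
  congr 1
  refine Multiset.map_congr rfl fun x hx => ?_
  have : x ≠ u := by exact Finset.ne_of_mem_erase (s := Finset.univ) hx
  rw [hsome, if_neg this]

lemma Graphic.split_all {B R : Multiset ℕ} (h : Graphic (B.map (· + 1) + R)) :
    Graphic (B + Multiset.replicate B.card 1 + R) := by
  induction B using Multiset.induction_on generalizing R with
  | empty => simpa using h
  | cons b B ih =>
    rw [Multiset.map_cons, Multiset.cons_add] at h
    have := @ih (b ::ₘ 1 ::ₘ R) (by simpa using h.split)
    rw [Multiset.card_cons, Multiset.replicate_succ, Multiset.cons_add, Multiset.add_cons,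
      Multiset.cons_add, Multiset.cons_add]
    simpa using this

/-- Adjoin a vertex of degree `d` raising the degrees in `U`, absorbing superfluous leaves. -/
lemma Graphic.adjoin_vertex {d k : ℕ} {U T : Multiset ℕ} (hd : 1 ≤ d)
    (h : Graphic (U + Multiset.replicate k 1 + T)) (hU : U.card = d + k)
    (hUd : ∀ a ∈ U, a + 1 ≤ d) (hT : ∀ a ∈ T, a ≤ d) :
    Graphic (d ::ₘ U.map (· + 1) + T) := by
  classical
  obtain ⟨V, _, G, hG⟩ := h
  rw [degreeMultiset_eq_map, add_assoc] at hG
  obtain ⟨A, -, hA, hG'⟩ := exists_sdiff_of_map_eq_add hG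
  obtain ⟨L, hLs, hL, hB⟩ := exists_sdiff_of_map_eq_add hG'
  have hAL : Disjoint A L := by
    rw [Finset.disjoint_left]
    intro x hx hx'
    simpa [hx] using hLs hx'
  have hAdeg : ∀ x ∈ A, ndeg G x + 1 ≤ d := fun x hx =>
    hUd _ (hA ▸ Multiset.mem_map_of_mem _ hx)
  have hLdeg : ∀ x ∈ L, ndeg G x = 1 := fun x hx =>
    Multiset.eq_of_mem_replicate (hL ▸ Multiset.mem_map_of_mem _ hx)
  have hBdeg : ∀ x, x ∉ A → x ∉ L → ndeg G x ≤ d := fun x hx hx' =>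
    hT _ (hB ▸ Multiset.mem_map_of_mem _ (show x ∈ (Finset.univ \ A) \ L by simp [hx, hx']))
  have hAcard : A.card = d + k := by
    rw [← hU, ← hA, Multiset.card_map]; rfl
  have hLcard : L.card = k := by
    have := congrArg Multiset.card hL
    simpa using this
  obtain ⟨H, hH1, hH2⟩ := exists_absorb_leaves (v := none) (L.map Function.Embedding.some)
    (by simp) (coneGraph G A)
    (by
      intro l hl
      obtain ⟨x, hx, rfl⟩ := Finset.mem_map.1 hl
      have hxA : x ∉ A := fun h => Finset.disjoint_left.1 hAL h hx
      exact ⟨by simp [ndeg_coneGraph_some, hxA, hLdeg x hx], hxA⟩)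
    (by rw [ndeg_coneGraph_none, Finset.card_map, hAcard, hLcard])
    (by
      rintro (_ | x) hx
      · simp at hx
      · rw [ndeg_coneGraph_some]
        split_ifs with hxA
        · exact hAdeg x hxA
        · by_cases hxL : x ∈ L
          · simpa [hLdeg x hxL] using hd
          · simpa using hBdeg x hxA hxL)
  have hsome : ∀ x, ndeg H (some x)
      = if x ∈ L then 0 else ndeg G x + if x ∈ A then 1 else 0 := by
    intro x
    rw [hH2 _ (by simp), ndeg_coneGraph_some]
    simp
  refine Graphic.of_add_replicate_zero (k := k) ⟨Option V, inferInstance, H, ?_⟩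
  rw [degreeMultiset_eq_map, univ_option_map, hH1, Multiset.cons_add, Multiset.cons_add]
  congr 1
  have hu : (Finset.univ : Finset V).val = A.val + (L.val + ((Finset.univ \ A) \ L).val) := by
    have h1 : (Finset.univ : Finset V) = A.disjUnion (Finset.univ \ A) Finset.disjoint_sdiff := by
      simp
    have h2 : (Finset.univ \ A) = L.disjUnion ((Finset.univ \ A) \ L) Finset.disjoint_sdiff := by
      simp [Finset.union_sdiff_of_subset hLs]
    conv_lhs => rw [h1, Finset.disjUnion_val]
    conv_lhs => rw [h2, Finset.disjUnion_val]
  rw [hu, Multiset.map_add, Multiset.map_add, ← hA, ← hB, Multiset.map_map]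
  have e1 : A.val.map (fun x => ndeg H (some x)) = A.val.map ((· + 1) ∘ ndeg G) := by
    refine Multiset.map_congr rfl fun x hx => ?_
    have hxL : x ∉ L := Finset.disjoint_left.1 hAL hx
    rw [hsome, if_neg hxL, if_pos (by simpa using hx)]
    rfl
  have e2 : L.val.map (fun x => ndeg H (some x)) = Multiset.replicate k 0 := by
    rw [Multiset.eq_replicate]
    refine ⟨by rw [Multiset.card_map]; exact hLcard, fun b hb => ?_⟩
    obtain ⟨x, hx, rfl⟩ := Multiset.mem_map.1 hb
    rw [hsome, if_pos (by simpa using hx)]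
  have e3 : ((Finset.univ \ A) \ L).val.map (fun x => ndeg H (some x))
      = ((Finset.univ \ A) \ L).val.map (ndeg G) := by
    refine Multiset.map_congr rfl fun x hx => ?_
    have hx' : x ∈ (Finset.univ \ A) \ L := hx
    simp only [Finset.mem_sdiff, Finset.mem_univ, true_and] at hx'
    rw [hsome, if_neg hx'.2, if_neg hx'.1, add_zero]
  rw [e1, e2, e3, add_assoc, add_comm (Multiset.replicate k 0)]

section Stars

variable {V : Type*}

/-- The star with centre `v` and set of leaves `t`, as a subgraph. -/
def starSubgraph (G : SimpleGraph V) (v : V) (t : Finset V) (h : ∀ u ∈ t, G.Adj v u) :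
    G.Subgraph where
  verts := insert v (t : Set V)
  Adj a b := (a = v ∧ b ∈ t) ∨ (b = v ∧ a ∈ t)
  adj_sub := by
    rintro a b (⟨rfl, hb⟩ | ⟨rfl, ha⟩)
    · exact h b hb
    · exact (h a ha).symm
  edge_vert := by
    rintro a b (⟨rfl, hb⟩ | ⟨rfl, ha⟩)
    · exact Set.mem_insert _ _
    · exact Set.mem_insert_of_mem _ ha
  symm := ⟨fun a b h => h.symm⟩

lemma starGraph_adj {j : ℕ} (a b : Fin (j + 1)) :
    (starGraph j).Adj a b ↔ a ≠ b ∧ (a = 0 ∨ b = 0) := by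
  simp [starGraph]

lemma nonempty_iso_starSubgraph (G : SimpleGraph V) (v : V) (t : Finset V)
    (h : ∀ u ∈ t, G.Adj v u) {j : ℕ} (hj : t.card = j) :
    Nonempty (starGraph j ≃g (starSubgraph G v t h).coe) := by
  subst hj
  have hv : v ∉ t := fun hv => G.irrefl (h v hv)
  let e := t.equivFin.symm
  let f : Fin (t.card + 1) → (starSubgraph G v t h).verts :=
    Fin.cons ⟨v, Set.mem_insert _ _⟩ fun i => ⟨e i, Set.mem_insert_of_mem _ (e i).2⟩
  have hf0 : (f 0 : V) = v := rfl
  have hfs : ∀ i : Fin t.card, (f i.succ : V) = e i := fun i => rfl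
  have hf : Function.Bijective f := by
    constructor
    · intro a b hab
      have hab' := congrArg Subtype.val hab
      induction a using Fin.cases with
      | zero =>
        induction b using Fin.cases with
        | zero => rfl
        | succ b =>
          rw [hf0, hfs] at hab'
          exact absurd (hab' ▸ (e b).2) hv
      | succ a =>
        induction b using Fin.cases with
        | zero =>
          rw [hf0, hfs] at hab'
          exact absurd (hab' ▸ (e a).2) hv
        | succ b =>
          rw [hfs, hfs] at hab'
          rw [e.injective (Subtype.ext hab')]
    · rintro ⟨u, hu⟩
      rcases hu with rfl | hu
      · exact ⟨0, rfl⟩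
      · refine ⟨(t.equivFin ⟨u, hu⟩).succ, Subtype.ext ?_⟩
        rw [hfs]
        simp [e]
  refine ⟨⟨Equiv.ofBijective f hf, ?_⟩⟩
  intro a b
  rw [starGraph_adj]
  change ((f a : V) = v ∧ (f b : V) ∈ t ∨ (f b : V) = v ∧ (f a : V) ∈ t) ↔ _
  have hne : ∀ i, (e i : V) ≠ v := fun i hi => hv (hi ▸ (e i).2)
  induction a using Fin.cases <;> induction b using Fin.cases <;>
    simp [hf0, hfs, hv, hne, Fin.succ_ne_zero, (Fin.succ_ne_zero _).symm]

lemma exists_eq_starSubgraph {G : SimpleGraph V} {j : ℕ} {H : G.Subgraph}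
    (φ : starGraph j ≃g H.coe) :
    ∃ (v : V) (t : Finset V) (h : ∀ u ∈ t, G.Adj v u), t.card = j ∧ starSubgraph G v t h = H := by
  classical
  let g : Fin j ↪ V := ⟨fun i => φ i.succ, fun a b hab =>
    Fin.succ_injective _ (φ.injective (Subtype.ext hab))⟩
  have hadj : ∀ a b, H.Adj (φ a) (φ b) ↔ a ≠ b ∧ (a = 0 ∨ b = 0) := fun a b => by
    rw [← starGraph_adj, ← φ.map_adj_iff]
    rfl
  have ht : ∀ u, u ∈ Finset.univ.map g ↔ ∃ i : Fin j, (φ i.succ : V) = u := by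
    intro u
    rw [Finset.mem_map]
    simp only [Finset.mem_univ, true_and]
    rfl
  refine ⟨φ 0, Finset.univ.map g, ?_, by simp, ?_⟩
  · intro u hu
    obtain ⟨i, rfl⟩ := (ht u).1 hu
    exact H.adj_sub ((hadj _ _).2 ⟨(Fin.succ_ne_zero _).symm, Or.inl rfl⟩)
  · apply SimpleGraph.Subgraph.ext
    · ext u
      change (u = φ 0 ∨ u ∈ Finset.univ.map g) ↔ _
      rw [ht]
      constructor
      · rintro (rfl | ⟨i, rfl⟩)
        · exact (φ 0).2
        · exact (φ i.succ).2
      · intro hu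
        obtain ⟨a, ha⟩ := φ.surjective ⟨u, hu⟩
        have ha' : (φ a : V) = u := congrArg Subtype.val ha
        induction a using Fin.cases with
        | zero => exact Or.inl ha'.symm
        | succ i => exact Or.inr ⟨i, ha'⟩
    · ext u w
      change ((u = φ 0 ∧ w ∈ Finset.univ.map g) ∨ (w = φ 0 ∧ u ∈ Finset.univ.map g)) ↔ _
      rw [ht, ht]
      constructor
      · rintro (⟨rfl, i, rfl⟩ | ⟨rfl, i, rfl⟩)
        · exact (hadj _ _).2 ⟨(Fin.succ_ne_zero _).symm, Or.inl rfl⟩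
        · exact (hadj _ _).2 ⟨Fin.succ_ne_zero _, Or.inr rfl⟩
      · intro huw
        obtain ⟨a, ha⟩ := φ.surjective ⟨u, H.edge_vert huw⟩
        obtain ⟨b, hb⟩ := φ.surjective ⟨w, H.edge_vert huw.symm⟩
        have ha' : (φ a : V) = u := congrArg Subtype.val ha
        have hb' : (φ b : V) = w := congrArg Subtype.val hb
        subst ha' hb'
        obtain ⟨hab, rfl | rfl⟩ := (hadj _ _).1 huw
        · obtain ⟨i, rfl⟩ := Fin.exists_succ_eq.2 hab.symm
          exact Or.inl ⟨rfl, i, rfl⟩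
        · obtain ⟨i, rfl⟩ := Fin.exists_succ_eq.2 hab
          exact Or.inr ⟨rfl, i, rfl⟩

lemma starSubgraph_inj {G : SimpleGraph V} {v v' : V} {t t' : Finset V}
    {h : ∀ u ∈ t, G.Adj v u} {h' : ∀ u ∈ t', G.Adj v' u} (ht : 2 ≤ t.card)
    (he : starSubgraph G v t h = starSubgraph G v' t' h') : v = v' ∧ t = t' := by
  have hv : v ∉ t := fun hv => G.irrefl (h v hv)
  have hv' : v' ∉ t' := fun hv => G.irrefl (h' v' hv)
  have hadj : ∀ a b, ((a = v ∧ b ∈ t) ∨ (b = v ∧ a ∈ t)) ↔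
      ((a = v' ∧ b ∈ t') ∨ (b = v' ∧ a ∈ t')) := fun a b =>
    iff_of_eq (congrArg (fun H : G.Subgraph => H.Adj a b) he)
  have hvv : v = v' := by
    by_contra hne
    have : t ⊆ {v'} := by
      intro u hu
      have := (hadj v u).1 (Or.inl ⟨rfl, hu⟩)
      rw [Finset.mem_singleton]
      tauto
    have := Finset.card_le_card this
    rw [Finset.card_singleton] at this
    omega
  subst hvv
  refine ⟨rfl, Finset.ext fun u => ?_⟩
  have := hadj v u
  tauto

lemma subCount_starGraph [Fintype V] (G : SimpleGraph V) {j : ℕ} (hj : 2 ≤ j) :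
    subCount (starGraph j) G = ((degreeMultiset G).map fun a : ℕ => a.choose j).sum := by
  classical
  have hadj : ∀ v, ∀ t ∈ (G.neighborFinset v).powersetCard j, ∀ u ∈ t, G.Adj v u :=
    fun v t ht u hu => (G.mem_neighborFinset _ _).1 ((Finset.mem_powersetCard.1 ht).1 hu)
  let F : (Σ v : V, {t // t ∈ (G.neighborFinset v).powersetCard j}) →
      {H : G.Subgraph // Nonempty (starGraph j ≃g H.coe)} := fun p =>
    ⟨starSubgraph G p.1 p.2.1 (hadj _ _ p.2.2),
      nonempty_iso_starSubgraph G _ _ _ (Finset.mem_powersetCard.1 p.2.2).2⟩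
  have hF : Function.Bijective F := by
    constructor
    · rintro ⟨v, t, ht⟩ ⟨v', t', ht'⟩ h
      obtain ⟨rfl, rfl⟩ := starSubgraph_inj (h := hadj v t ht) (h' := hadj v' t' ht')
        (hj.trans_eq (Finset.mem_powersetCard.1 ht).2.symm) (congrArg Subtype.val h)
      rfl
    · rintro ⟨H, ⟨φ⟩⟩
      obtain ⟨v, t, h, hc, rfl⟩ := exists_eq_starSubgraph φ
      refine ⟨⟨v, t, Finset.mem_powersetCard.2 ⟨fun u hu => ?_, hc⟩⟩, rfl⟩
      exact (G.mem_neighborFinset _ _).2 (h u hu)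
  rw [subCount, ← Nat.card_eq_of_bijective F hF, Nat.card_eq_fintype_card, Fintype.card_sigma,
    degreeMultiset, Multiset.map_map]
  change _ = ∑ v, _
  refine Finset.sum_congr rfl fun v _ => ?_
  rw [Fintype.card_coe, Finset.card_powersetCard]
  simp [Set.ncard_eq_toFinset_card', SimpleGraph.neighborFinset]

end Stars

lemma two_mul_ncard_edgeSet {V : Type*} [Fintype V] (G : SimpleGraph V) :
    2 * G.edgeSet.ncard = (degreeMultiset G).sum := by
  classical
  have h := G.sum_degrees_eq_twice_card_edges
  rw [Set.ncard_eq_toFinset_card', degreeMultiset]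
  change _ = ∑ v, _
  rw [← SimpleGraph.edgeFinset, ← h]
  refine Finset.sum_congr rfl fun v _ => ?_
  simp [Set.ncard_eq_toFinset_card', ← SimpleGraph.card_neighborSet_eq_degree]

lemma exists_antitone_enumeration (M : Multiset ℕ) :
    ∃ d : ℕ → ℕ, (∀ i j, 1 ≤ i → i ≤ j → j ≤ M.card → d j ≤ d i) ∧
      (Finset.Icc 1 M.card).val.map d = M := by
  set l := M.sort (· ≥ ·) with hl
  have hlen : l.length = M.card := Multiset.length_sort _
  have hsort : l.Pairwise (· ≥ ·) := Multiset.pairwise_sort M (· ≥ ·)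
  refine ⟨fun i => l.getD (i - 1) 0, fun i j hi hij hj => ?_, ?_⟩
  · have h1 : i - 1 < l.length := by omega
    have h2 : j - 1 < l.length := by omega
    simp only [List.getD_eq_getElem _ _ h1, List.getD_eq_getElem _ _ h2]
    rcases hij.eq_or_lt with rfl | hij
    · rfl
    · exact List.pairwise_iff_getElem.1 hsort _ _ h1 h2 (by omega)
  · have hIcc : Finset.Icc 1 M.card = (Finset.range M.card).map (addRightEmbedding 1) := by
      ext i
      simp only [Finset.mem_Icc, Finset.mem_map, Finset.mem_range, addRightEmbedding_apply]
      exact ⟨fun h => ⟨i - 1, by omega, by omega⟩, by rintro ⟨a, ha, rfl⟩; omega⟩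
    rw [hIcc, Finset.map_val, Multiset.map_map, Finset.range_val, ← hlen]
    conv_rhs => rw [← Multiset.sort_eq M (· ≥ ·), ← hl]
    rw [Multiset.range, Multiset.map_coe]
    congr 1
    apply List.ext_getElem
    · simp
    · intro n h1 h2
      simp [h2]

lemma DP_iff {ℓ : ℕ} (hℓ : 1 ≤ ℓ) (s : ℕ → ℕ) (m x : ℕ) :
    DP ℓ s m x ↔ ∃ M : Multiset ℕ, M.card = s 0 ∧ (∀ a ∈ M, a ≤ m) ∧
      Graphic (M + Multiset.replicate x 1) ∧
      ∀ j ∈ Finset.Icc 1 ℓ, (M.map fun a : ℕ => a.choose j).sum = s j := by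
  have hstar : ∀ (M : Multiset ℕ) (j : ℕ), 2 ≤ j →
      ((M + Multiset.replicate x 1).map fun a : ℕ => a.choose j).sum
        = (M.map fun a : ℕ => a.choose j).sum := by
    intro M j hj
    simp [Nat.choose_eq_zero_of_lt (show 1 < j by omega)]
  have hone : ∀ M : Multiset ℕ, (M.map fun a : ℕ => a.choose 1).sum = M.sum := by
    intro M
    simp
  constructor
  · rintro ⟨d, -, hm, V, _, G, hG, -, hE, hS⟩
    refine ⟨(Finset.Icc 1 (s 0)).val.map d, by simp, ?_, ⟨V, _, G, hG⟩, fun j hj => ?_⟩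
    · intro a ha
      obtain ⟨i, hi, rfl⟩ := Multiset.mem_map.1 ha
      exact hm i hi
    · rw [Finset.mem_Icc] at hj
      rcases hj.1.eq_or_lt with rfl | hj1
      · rw [two_mul_ncard_edgeSet, hG, Multiset.sum_add, Multiset.sum_replicate] at hE
        rw [hone]
        simp only [smul_eq_mul, mul_one] at hE
        omega
      · rw [← hS j (Finset.mem_Icc.2 ⟨hj1, hj.2⟩), subCount_starGraph _ hj1, hG, hstar _ _ hj1]
  · rintro ⟨M, hM, hm, ⟨V, _, G, hG⟩, hS⟩
    obtain ⟨d, hd, hdM⟩ := exists_antitone_enumeration M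
    rw [hM] at hd hdM
    refine ⟨d, hd, fun i hi => hm _ (hdM ▸ Multiset.mem_map_of_mem _ hi), V, _, G,
      by rw [hG, hdM], ?_, ?_, fun j hj => ?_⟩
    · have := congrArg Multiset.card hG
      simpa [degreeMultiset, hM] using this
    · have := hS 1 (Finset.mem_Icc.2 ⟨le_rfl, hℓ⟩)
      rw [hone] at this
      rw [two_mul_ncard_edgeSet, hG, Multiset.sum_add, this]
      simp
    · rw [Finset.mem_Icc] at hj
      rw [subCount_starGraph _ hj.1, hG, hstar _ _ hj.1]
      exact hS j (Finset.mem_Icc.2 ⟨by omega, hj.2⟩)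

lemma sum_choose_map_succ (Q : Multiset ℕ) {j : ℕ} (hj : 1 ≤ j) :
    ((Q.map (· + 1)).map fun a : ℕ => a.choose j).sum
      = (Q.map fun a : ℕ => a.choose j).sum + (Q.map fun a : ℕ => a.choose (j - 1)).sum := by
  obtain ⟨j, rfl⟩ := Nat.exists_eq_add_of_le' hj
  rw [Multiset.map_map, ← Multiset.sum_map_add]
  congr 1
  refine Multiset.map_congr rfl fun a _ => ?_
  simp [Nat.choose_succ_succ, add_comm]

/-- Every multiset of naturals splits into successors and zeros. -/
lemma exists_eq_map_succ_add_replicate_zero (M : Multiset ℕ) :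
    ∃ (Q : Multiset ℕ) (z : ℕ), M = Q.map (· + 1) + Multiset.replicate z 0 := by
  induction M using Multiset.induction_on with
  | empty => exact ⟨0, 0, by simp⟩
  | cons a M ih =>
    obtain ⟨Q, z, rfl⟩ := ih
    rcases a with _ | a
    · exact ⟨Q, z + 1, by rw [Multiset.replicate_succ, Multiset.add_cons]⟩
    · exact ⟨a ::ₘ Q, z, by simp⟩

/-- The forward step of the recursion: delete a vertex of degree `d` and split an edge end off
every vertex of `Q.map (· + 1)` not adjacent to it. -/
lemma Graphic.reduce {d x : ℕ} {Q : Multiset ℕ}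
    (h : Graphic (d ::ₘ Q.map (· + 1) + Multiset.replicate x 1)) :
    d ≤ Q.card + x ∧ Graphic (Q + Multiset.replicate (x + Q.card - d) 1) := by
  rw [Multiset.cons_add] at h
  obtain ⟨S, T, hS, hR, hG⟩ := h.delete_vertex
  have hX : Multiset.replicate x 1 = (Multiset.replicate x 0).map (· + 1) := by simp
  have hT : ∃ T' : Multiset ℕ, T = T'.map (· + 1) := by
    obtain ⟨T', z, hT'⟩ := exists_eq_map_succ_add_replicate_zero T
    refine ⟨T', ?_⟩
    rcases z with _ | z
    · simpa using hT'
    · exfalso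
      have : 0 ∈ Q.map (· + 1) + Multiset.replicate x 1 := by
        rw [hR, hT', Multiset.replicate_succ]
        simp
      rw [hX, ← Multiset.map_add] at this
      obtain ⟨a, -, ha⟩ := Multiset.mem_map.1 this
      omega
  obtain ⟨T, rfl⟩ := hT
  rw [hX, ← Multiset.map_add, ← Multiset.map_add] at hR
  replace hR := Multiset.map_injective (add_left_injective 1) hR
  have hcard := congrArg Multiset.card hR
  simp only [Multiset.card_add, Multiset.card_replicate] at hcard
  refine ⟨by omega, ?_⟩
  obtain ⟨A, B, y, z, hSA, hTB, hQ, hx⟩ : ∃ (A B : Multiset ℕ) (y z : ℕ),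
      S = A + Multiset.replicate z 0 ∧ T = B + Multiset.replicate y 0 ∧ Q = A + B ∧
        x = z + y := by
    have hle : T - Q ≤ Multiset.replicate x 0 := by
      rw [tsub_le_iff_left, hR]
      exact Multiset.le_add_left _ _
    obtain ⟨y, hy⟩ : ∃ y, T - Q = Multiset.replicate y 0 :=
      ⟨_, Multiset.eq_replicate_card.2 fun b hb =>
        Multiset.eq_of_mem_replicate (Multiset.mem_of_le hle hb)⟩
    have hyx : y ≤ x := by
      rw [hy] at hle
      simpa using Multiset.card_le_card hle
    have hcount : ∀ a, Q.count a + (Multiset.replicate x 0).count a = S.count a + T.count a := by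
      intro a
      rw [← Multiset.count_add, ← Multiset.count_add, hR]
    have hcount' : ∀ a, T.count a - Q.count a = (Multiset.replicate y 0).count a := by
      intro a
      rw [← hy, Multiset.count_sub]
    refine ⟨Q - T, Q ∩ T, y, x - y, ?_, ?_, ?_, by omega⟩
    all_goals
      ext a
      have h1 := hcount a
      have h2 := hcount' a
      simp only [Multiset.count_add, Multiset.count_sub, Multiset.count_inter,
        Multiset.count_replicate] at h1 h2 ⊢
      split_ifs at h1 h2 ⊢ <;> omega
  subst hSA hTB hQ hx
  rw [Multiset.map_add, Multiset.map_replicate, zero_add, add_left_comm] at hG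
  have := hG.split_all
  rw [add_comm] at this
  refine Graphic.of_add_replicate_zero (k := z) ?_
  convert this using 1
  rw [Multiset.card_add, Multiset.card_replicate] at hS
  rw [Multiset.card_add, show z + y + (A.card + B.card) - d = B.card + y by omega,
    Multiset.replicate_add]
  abel

/-- The backward step of the recursion. -/
lemma Graphic.extend {d x x' : ℕ} {Q : Multiset ℕ} (hd : 1 ≤ d) (hQ : ∀ a ∈ Q, a + 1 ≤ d)
    (hx : x' + d = x + Q.card) (h : Graphic (Q + Multiset.replicate x' 1)) :
    Graphic (d ::ₘ Q.map (· + 1) + Multiset.replicate x 1) := by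
  have hG := h.add_replicate_zero (d - Q.card)
  have e1 : Q + Multiset.replicate x' 1 + Multiset.replicate (d - Q.card) 0
      = (Q + Multiset.replicate (d - Q.card) 0) + Multiset.replicate (Q.card - d) 1
        + Multiset.replicate (x' - (Q.card - d)) 1 := by
    rw [add_assoc (Q + _), ← Multiset.replicate_add,
      show Q.card - d + (x' - (Q.card - d)) = x' by omega, add_right_comm]
  rw [e1] at hG
  have := hG.adjoin_vertex hd (by simp; omega)
    (by
      intro a ha
      rcases Multiset.mem_add.1 ha with ha | ha
      · exact hQ a ha
      · rw [Multiset.eq_of_mem_replicate ha]; omega)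
    (by
      intro a ha
      rw [Multiset.eq_of_mem_replicate ha]; omega)
  convert this using 1
  rw [Multiset.map_add, Multiset.map_replicate, Multiset.cons_add, Multiset.cons_add, add_assoc,
    zero_add, ← Multiset.replicate_add]
  congr 3
  omega

/-- the recursion underlying the dynamic programming algorithm. -/
theorem stmt8 (ℓ : ℕ) (hℓ : 1 ≤ ℓ) (s : ℕ → ℕ) (m x : ℕ)
    (hs0 : 2 ≤ s 0) (hs1 : 1 ≤ s 1) :
    DP ℓ s m x ↔
    ∃ d ∈ Finset.Icc 1 m, ∃ n₁ ∈ Finset.Icc 1 (s 0),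
      ∃ (s' : ℕ → ℕ) (m' x' : ℕ),
        d ≤ n₁ - 1 + x ∧
        s' 0 = n₁ - 1 ∧
        (∀ j ∈ Finset.Icc 1 ℓ, s j = s' j + Nat.choose d j + s' (j - 1)) ∧
        m' = d - 1 ∧
        x' + d = x + n₁ - 1 ∧
        DP ℓ s' m' x' := by
  rw [DP_iff hℓ]
  constructor
  · rintro ⟨M, hM, hm, hG, hS⟩
    have hS1 := hS 1 (Finset.mem_Icc.2 ⟨le_rfl, hℓ⟩)
    have hne : M ≠ 0 := by rintro rfl; simp at hM; omega
    obtain ⟨d, hdM, hdmax⟩ : ∃ d ∈ M, ∀ a ∈ M, a ≤ d := by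
      obtain ⟨d, hd, hmax⟩ := M.toFinset.exists_max_image id (by simpa using hne)
      exact ⟨d, by simpa using hd, fun a ha => hmax a (by simpa using ha)⟩
    have hd : 1 ≤ d := by
      by_contra hd0
      have : ∀ a ∈ M, a = 0 := fun a ha => by have := hdmax a ha; omega
      rw [Multiset.eq_replicate_card.2 this] at hS1
      simp at hS1
      omega
    obtain ⟨M, rfl⟩ := Multiset.exists_cons_of_mem hdM
    obtain ⟨Q, z, rfl⟩ := exists_eq_map_succ_add_replicate_zero M
    have hG' : Graphic (d ::ₘ Q.map (· + 1) + Multiset.replicate x 1) := by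
      apply Graphic.of_add_replicate_zero (k := z)
      rwa [← Multiset.cons_add, add_right_comm] at hG
    obtain ⟨hdx, hQ⟩ := hG'.reduce
    simp only [Multiset.card_cons, Multiset.card_add, Multiset.card_map,
      Multiset.card_replicate] at hM
    refine ⟨d, Finset.mem_Icc.2 ⟨hd, hm d (by simp)⟩, Q.card + 1,
      Finset.mem_Icc.2 ⟨by omega, by omega⟩, fun j => (Q.map fun a : ℕ => a.choose j).sum, d - 1,
      x + Q.card - d, by omega, by simp, ?_, rfl, by omega, ?_⟩
    · intro j hj
      rw [← hS j hj]
      rw [Finset.mem_Icc] at hj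
      rw [Multiset.map_cons, Multiset.map_add, Multiset.sum_cons, Multiset.sum_add,
        sum_choose_map_succ _ hj.1, Multiset.map_replicate,
        Nat.choose_eq_zero_of_lt (show 0 < j by omega)]
      simp
      ring
    · rw [DP_iff hℓ]
      refine ⟨Q, by simp, fun a ha => ?_, hQ, fun j _ => rfl⟩
      have := hdmax (a + 1) (by simp [ha])
      omega
  · rintro ⟨d, hd, n₁, hn, s', m', x', hdx, hs', hrec, rfl, hx, hDP⟩
    rw [DP_iff hℓ] at hDP
    obtain ⟨Q, hQ, hQm, hG, hS⟩ := hDP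
    rw [Finset.mem_Icc] at hd hn
    have hQd : ∀ a ∈ Q, a + 1 ≤ d := fun a ha => by have := hQm a ha; omega
    refine ⟨d ::ₘ Q.map (· + 1) + Multiset.replicate (s 0 - n₁) 0, ?_, ?_, ?_, ?_⟩
    · simp
      omega
    · intro a ha
      simp only [Multiset.mem_add, Multiset.mem_cons, Multiset.mem_map,
        Multiset.mem_replicate] at ha
      rcases ha with (rfl | ⟨b, hb, rfl⟩) | ⟨-, rfl⟩
      · exact hd.2
      · exact (hQd b hb).trans hd.2
      · omega
    · rw [add_right_comm]
      exact (hG.extend hd.1 hQd (by omega)).add_replicate_zero _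
    · intro j hj
      have hj1 := (Finset.mem_Icc.1 hj).1
      have hj' : (Q.map fun a : ℕ => a.choose (j - 1)).sum = s' (j - 1) := by
        rcases hj1.eq_or_lt with rfl | h
        · simp [hQ]
        · exact hS _ (Finset.mem_Icc.2 ⟨by omega, by have := (Finset.mem_Icc.1 hj).2; omega⟩)
      rw [hrec j hj, Multiset.map_add, Multiset.map_cons, Multiset.sum_add, Multiset.sum_cons,
        sum_choose_map_succ _ hj1, hS j hj, hj', Multiset.map_replicate,
        Nat.choose_eq_zero_of_lt (show 0 < j by omega)]
      simp
      ring
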